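/- Let 2 < p < 4 and define F_p(s) = ((4-p)/2 + ((p-2)/2)·s⁴)·B(2/p, 1 - 2/p) - ∫_0^1 t^{2/p - 1}(1-t)^{-2/p}·(max{s², t²})^{p-2} dt for s ∈ [0,1]. Then for every s ∈ (0,1), F_p is differentiable at s with F_p'(s) = 2(p-2)·s^{2p-5}·( B(2/p, 1 - 2/p)·s^{8-2p} - ∫_0^s t^{2/p - 1}(1-t)^{-2/p} dt ). -/

import Mathlib

open MeasureTheory

/-- The real Beta function, `B(x,y) = ∫_0^1 t^(x-1) (1-t)^(y-1) dt`. -/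
noncomputable def realBeta (x y : ℝ) : ℝ :=
  ∫ t in (0:ℝ)..1, t ^ (x - 1) * (1 - t) ^ (y - 1)

lemma intervalIntegrable_rpow_mul_one_sub_rpow {x y : ℝ} (hx : 0 < x) (hy : 0 < y) :
    IntervalIntegrable (fun t : ℝ => t ^ (x - 1) * (1 - t) ^ (y - 1)) volume 0 1 := by
  have h := (Complex.betaIntegral_convergent (u := x) (v := y) (by simpa) (by simpa)).norm
  refine h.congr_uIoo ?_
  intro t ht
  rw [Set.uIoo_of_le zero_le_one] at ht
  have h1 : 0 < 1 - t := by linarith [ht.2]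
  have e1 : ‖(t : ℂ) ^ ((x : ℂ) - 1)‖ = t ^ (x - 1) := by
    rw [Complex.norm_cpow_eq_rpow_re_of_pos ht.1]; simp
  have e2 : ‖(1 - (t : ℂ)) ^ ((y : ℂ) - 1)‖ = (1 - t) ^ (y - 1) := by
    have := Complex.norm_cpow_eq_rpow_re_of_pos h1 ((y : ℂ) - 1)
    simpa using this
  simp only [norm_mul, e1, e2]

lemma integral_mul_comp_max {f g : ℝ → ℝ} (hf : IntervalIntegrable f volume 0 1)
    (hg : Continuous g) {s : ℝ} (hs0 : 0 < s) (hs1 : s < 1) :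
    ∫ t in (0 : ℝ)..1, f t * g (max s t) =
      (∫ t in (0 : ℝ)..s, f t) * g s + ∫ t in s..1, f t * g t := by
  have hi : IntervalIntegrable (fun t => f t * g (max s t)) volume 0 1 :=
    hf.mul_continuousOn (by fun_prop)
  have hm : s ∈ Set.uIcc (0 : ℝ) 1 := by
    rw [Set.uIcc_of_le zero_le_one]; exact ⟨hs0.le, hs1.le⟩
  rw [← intervalIntegral.integral_add_adjacent_intervals
    (hi.mono_set (Set.uIcc_subset_uIcc_left hm)) (hi.mono_set (Set.uIcc_subset_uIcc_right hm)),
    ← intervalIntegral.integral_mul_const]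
  congr 1
  · refine intervalIntegral.integral_congr fun t ht => ?_
    rw [Set.uIcc_of_le hs0.le] at ht
    simp only [max_eq_left ht.2]
  · refine intervalIntegral.integral_congr fun t ht => ?_
    rw [Set.uIcc_of_le hs1.le] at ht
    simp only [max_eq_right ht.1]

/-- The boundary terms coming from the two halves of the integral cancel. -/
lemma hasDerivAt_integral_mul_comp_max {f g : ℝ → ℝ} {g' s : ℝ}
    (hf : IntervalIntegrable f volume 0 1) (hfm : Measurable f) (hg : Continuous g)
    (hs0 : 0 < s) (hs1 : s < 1) (hfs : ContinuousAt f s) (hgs : HasDerivAt g g' s) :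
    HasDerivAt (fun u => ∫ t in (0 : ℝ)..1, f t * g (max u t))
      ((∫ t in (0 : ℝ)..s, f t) * g') s := by
  have hm : s ∈ Set.uIcc (0 : ℝ) 1 := by
    rw [Set.uIcc_of_le zero_le_one]; exact ⟨hs0.le, hs1.le⟩
  have hl := intervalIntegral.integral_hasDerivAt_right
    (hf.mono_set (Set.uIcc_subset_uIcc_left hm))
    hfm.stronglyMeasurable.stronglyMeasurableAtFilter hfs
  have hr := intervalIntegral.integral_hasDerivAt_left
    ((hf.mul_continuousOn hg.continuousOn).mono_set (Set.uIcc_subset_uIcc_right hm))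
    (hfm.mul hg.measurable).stronglyMeasurable.stronglyMeasurableAtFilter
    (hfs.mul hg.continuousAt)
  have h := (hl.mul hgs).add hr
  refine (h.congr_of_eventuallyEq ?_).congr_deriv (by ring)
  filter_upwards [Ioo_mem_nhds hs0 hs1] with u hu
  exact integral_mul_comp_max hf hg hu.1 hu.2

theorem F_hasDerivAt (p : ℝ) (hp2 : 2 < p) (hp4 : p < 4) (s : ℝ) (hs0 : 0 < s) (hs1 : s < 1) :
    HasDerivAt
      (fun s : ℝ => ((4 - p) / 2 + (p - 2) / 2 * s ^ 4) * realBeta (2 / p) (1 - 2 / p)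
        - ∫ t in (0:ℝ)..1, t ^ (2 / p - 1) * (1 - t) ^ (-(2 / p)) * max (s ^ 2) (t ^ 2) ^ (p - 2))
      (2 * (p - 2) * s ^ (2 * p - 5) *
        (realBeta (2 / p) (1 - 2 / p) * s ^ (8 - 2 * p)
          - ∫ t in (0:ℝ)..s, t ^ (2 / p - 1) * (1 - t) ^ (-(2 / p))))
      s := by
  have hp0 : 0 < p := by linarith
  have hf : IntervalIntegrable (fun t : ℝ => t ^ (2 / p - 1) * (1 - t) ^ (-(2 / p)))
      volume 0 1 := by
    have h := intervalIntegrable_rpow_mul_one_sub_rpow (x := 2 / p) (y := 1 - 2 / p)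
      (by positivity) (sub_pos.2 ((div_lt_one hp0).2 hp2))
    rwa [show 1 - 2 / p - 1 = -(2 / p) by ring] at h
  have hfs : ContinuousAt (fun t : ℝ => t ^ (2 / p - 1) * (1 - t) ^ (-(2 / p))) s :=
    (continuousAt_id.rpow_const (Or.inl hs0.ne')).mul
      ((continuousAt_const.sub continuousAt_id).rpow_const (Or.inl (sub_pos.2 hs1).ne'))
  have hg : Continuous fun t : ℝ => (t ^ 2) ^ (p - 2) :=
    (continuous_pow 2).rpow_const fun _ => Or.inr (by linarith)
  have hgs : HasDerivAt (fun t : ℝ => (t ^ 2) ^ (p - 2)) (2 * (p - 2) * s ^ (2 * p - 5)) s := by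
    refine ((hasDerivAt_pow 2 s).rpow_const (Or.inl (by positivity))).congr_deriv ?_
    have e : (s ^ 2) ^ (p - 2 - 1) * s = s ^ (2 * p - 5) := by
      rw [← Real.rpow_natCast, ← Real.rpow_mul hs0.le, ← Real.rpow_add_one hs0.ne']
      congr 1; push_cast; ring
    rw [← e]; push_cast; ring
  have hI := hasDerivAt_integral_mul_comp_max hf (by fun_prop) hg hs0 hs1 hfs hgs
  have hP := ((((hasDerivAt_pow 4 s).const_mul ((p - 2) / 2)).const_add
    ((4 - p) / 2)).mul_const (realBeta (2 / p) (1 - 2 / p)))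
  refine ((hP.sub hI).congr_of_eventuallyEq ?_).congr_deriv ?_
  · filter_upwards [Ioi_mem_nhds hs0] with u hu
    simp only [Pi.sub_apply]
    congr 1
    refine intervalIntegral.integral_congr fun t ht => ?_
    rw [Set.uIcc_of_le zero_le_one] at ht
    have hmax : max (u ^ 2) (t ^ 2) = max u t ^ 2 := by
      rcases le_total u t with h | h
      · rw [max_eq_right h, max_eq_right (pow_le_pow_left₀ (le_of_lt hu) h 2)]
      · rw [max_eq_left h, max_eq_left (pow_le_pow_left₀ ht.1 h 2)]
    simp only [hmax]
  · have e : s ^ (2 * p - 5) * s ^ (8 - 2 * p) = s ^ 3 := by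
      rw [← Real.rpow_add hs0, ← Real.rpow_natCast]
      congr 1; push_cast; ring
    push_cast
    linear_combination -2 * (p - 2) * realBeta (2 / p) (1 - 2 / p) * e
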